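/- arXiv:1001.1805 — 2 statements merged into one kernel-verified Lean document; each statement's English description precedes it below -/
import Mathlib

section
/- Let f : D → D be holomorphic with f(0) = 0. Then for every ζ ∈ D with ζ ≠ 0, (1 − |f(ζ)|)/(1 − |ζ|) ≥ (1 + |ζ|)/(1 + |f'(0)|·|ζ|) ≥ 2/(1 + |f'(0)|) · (1 + |ζ|)/2; in particular (1 − |f(ζ)|)/(1 − |ζ|) ≥ (1 + |ζ|)/(1 + |f'(0)|·|ζ|). -/
open Complex Metric Set

theorem norm_one_sub_conj_mul_sq_sub_norm_sub_sq (b w : ℂ) :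
    ‖1 - (starRingEnd ℂ) b * w‖ ^ 2 - ‖w - b‖ ^ 2 = (1 - ‖b‖ ^ 2) * (1 - ‖w‖ ^ 2) := by
  simp only [← Complex.normSq_eq_norm_sq, Complex.normSq_apply, Complex.sub_re, Complex.sub_im,
    Complex.mul_re, Complex.mul_im, Complex.conj_re, Complex.conj_im, Complex.one_re,
    Complex.one_im]
  ring

/-- The growth form of the Schwarz–Pick lemma at the origin. -/
theorem norm_mul_le_of_mapsTo_unit_closedBall {g : ℂ → ℂ}
    (hg : DifferentiableOn ℂ g (ball 0 1)) (hmaps : MapsTo g (ball 0 1) (closedBall 0 1))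
    {z : ℂ} (hz : z ∈ ball (0 : ℂ) 1) :
    ‖g z‖ * (1 + ‖g 0‖ * ‖z‖) ≤ ‖g 0‖ + ‖z‖ := by
  have hle : ∀ w ∈ ball (0 : ℂ) 1, ‖g w‖ ≤ 1 := fun w hw => mem_closedBall_zero_iff.1 (hmaps hw)
  have hz1 : ‖z‖ < 1 := mem_ball_zero_iff.1 hz
  rcases (hle 0 (by simp)).eq_or_lt with ha | ha
  · rw [ha, one_mul]
    exact mul_le_of_le_one_left (by positivity) (hle z hz)
  have hlower : ∀ w, 1 - ‖g 0‖ * ‖g w‖ ≤ ‖1 - (starRingEnd ℂ) (g 0) * g w‖ := fun w => by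
    simpa using norm_sub_norm_le (1 : ℂ) ((starRingEnd ℂ) (g 0) * g w)
  have hprod : ∀ w ∈ ball (0 : ℂ) 1, 0 < 1 - ‖g 0‖ * ‖g w‖ := fun w hw =>
    sub_pos.2 <| (mul_le_of_le_one_right (norm_nonneg _) (hle w hw)).trans_lt ha
  have hpos : ∀ w ∈ ball (0 : ℂ) 1, 0 < ‖1 - (starRingEnd ℂ) (g 0) * g w‖ := fun w hw =>
    (hprod w hw).trans_le (hlower w)
  have hb : 0 < 1 - ‖g 0‖ ^ 2 := by nlinarith [norm_nonneg (g 0)]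
  have hschwarz := Complex.norm_le_norm_of_mapsTo_ball (R := 1) (z := z)
    (f := fun w => (g w - g 0) / (1 - (starRingEnd ℂ) (g 0) * g w))
    ((hg.sub_const _).div ((hg.const_mul _).const_sub _) fun w hw => norm_pos_iff.1 (hpos w hw))
    (fun w hw => by
      rw [mem_closedBall_zero_iff, norm_div, div_le_one (hpos w hw)]
      refine le_of_sq_le_sq ?_ (norm_nonneg _)
      have hw2 : 0 ≤ 1 - ‖g w‖ ^ 2 := by nlinarith [hle w hw, norm_nonneg (g w)]
      linarith [norm_one_sub_conj_mul_sq_sub_norm_sub_sq (g 0) (g w), mul_nonneg hb.le hw2])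
    (by simp) hz1
  rw [norm_div, div_le_iff₀ (hpos z hz)] at hschwarz
  have hsq := pow_le_pow_left₀ (norm_nonneg _) hschwarz 2
  have hlow := pow_le_pow_left₀ (hprod z hz).le (hlower z) 2
  have hid := norm_one_sub_conj_mul_sq_sub_norm_sub_sq (g 0) (g z)
  have hr : 0 ≤ 1 - ‖z‖ ^ 2 := by nlinarith [norm_nonneg z]
  have hkey : (‖g z‖ - ‖g 0‖) ^ 2 ≤ (‖z‖ * (1 - ‖g 0‖ * ‖g z‖)) ^ 2 := by
    linear_combination hsq + hid + mul_le_mul_of_nonneg_left hlow hr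
  have := abs_le_of_sq_le_sq' hkey (mul_nonneg (norm_nonneg _) (hprod z hz).le)
  linarith [this.2]

/-- If `f` is a holomorphic self-map of the unit disc with `f(0) = 0`, then for
every nonzero `ζ` in the disc,
`(1 - |f(ζ)|)/(1 - |ζ|) ≥ (1 + |ζ|)/(1 + |f'(0)| |ζ|)
   ≥ (2/(1 + |f'(0)|)) · (1 + |ζ|)/2`;
in particular `(1 - |f(ζ)|)/(1 - |ζ|) ≥ (1 + |ζ|)/(1 + |f'(0)| |ζ|)`. -/
theorem schwarz_radial_growth_bound
    (f : ℂ → ℂ)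
    (hf : DifferentiableOn ℂ f (ball (0 : ℂ) 1))
    (hmaps : Set.MapsTo f (ball (0 : ℂ) 1) (ball (0 : ℂ) 1))
    (hf0 : f 0 = 0) :
    ∀ ζ ∈ ball (0 : ℂ) 1, ζ ≠ 0 →
      ((1 + ‖ζ‖) / (1 + ‖deriv f 0‖ * ‖ζ‖)
          ≤ (1 - ‖f ζ‖) / (1 - ‖ζ‖) ∧
        2 / (1 + ‖deriv f 0‖) * ((1 + ‖ζ‖) / 2)
          ≤ (1 + ‖ζ‖) / (1 + ‖deriv f 0‖ * ‖ζ‖)) ∧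
      (1 + ‖ζ‖) / (1 + ‖deriv f 0‖ * ‖ζ‖) ≤ (1 - ‖f ζ‖) / (1 - ‖ζ‖) := by
  intro ζ hζ hζ0
  have hr : 0 < ‖ζ‖ := norm_pos_iff.2 hζ0
  have hr1 : ‖ζ‖ < 1 := mem_ball_zero_iff.1 hζ
  have hmaps' : MapsTo f (ball 0 1) (closedBall (f 0) 1) := by
    rw [hf0]
    exact hmaps.mono_right ball_subset_closedBall
  have hg : DifferentiableOn ℂ (dslope f 0) (ball 0 1) :=
    (Complex.differentiableOn_dslope (ball_mem_nhds 0 one_pos)).2 hf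
  have hpick := norm_mul_le_of_mapsTo_unit_closedBall hg (fun w hw => by
    simpa using Complex.norm_dslope_le_div_of_mapsTo_ball hf hmaps' hw) hζ
  have hfζ : ‖f ζ‖ = ‖ζ‖ * ‖dslope f 0 ζ‖ := by
    rw [← norm_mul]
    congr 1
    simpa [hf0] using (sub_smul_dslope f 0 ζ).symm
  rw [dslope_same] at hpick
  have hmain : (1 + ‖ζ‖) / (1 + ‖deriv f 0‖ * ‖ζ‖) ≤ (1 - ‖f ζ‖) / (1 - ‖ζ‖) := by
    rw [div_le_div_iff₀ (by positivity) (by linarith), hfζ]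
    linear_combination ‖ζ‖ * hpick
  refine ⟨⟨hmain, ?_⟩, hmain⟩
  calc 2 / (1 + ‖deriv f 0‖) * ((1 + ‖ζ‖) / 2) = (1 + ‖ζ‖) / (1 + ‖deriv f 0‖) := by
        field_simp
    _ ≤ (1 + ‖ζ‖) / (1 + ‖deriv f 0‖ * ‖ζ‖) := by
        gcongr
        exact mul_le_of_le_one_right (norm_nonneg _) hr1.le
end

section
/- (Generalization of Chelst's theorem.) Let f : D → D be holomorphic and let B : D → D be holomorphic and inner, meaning that for almost every θ ∈ [0, 2π) the radial limit B*(e^{iθ}) = lim_{r→1⁻} B(re^{iθ}) exists and has modulus 1. Let A_B ⊆ ∂D be precisely the set of boundary points b = e^{iθ} at which the radial limit of B exists and equals 1, and assume A_B has one-dimensional (arc-length) measure zero. Assume: (a) for a given point a ∈ A_B, f(ζ) = B(ζ) + O(|ζ − a|⁴) as ζ → a in D; (b) for every b ∈ A_B \ {a}, f(ζ) = B(ζ) + O(|ζ − b|²) as ζ → b in D. Then f(ζ) = B(ζ) for all ζ ∈ D. -/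
open Complex Metric Set Filter MeasureTheory Real
open scoped Topology ENNReal NNReal

/-- The Poisson integral over the unit circle of a measure on the plane. -/
noncomputable def poissonIntegral (μ : Measure ℂ) (w : ℂ) : ℝ :=
  ∫ ζ, poissonKernel 0 w ζ ∂μ

/-- Arc-length measure on the unit circle, as a measure on the plane. -/
noncomputable def arcLength : Measure ℂ :=
  (volume.restrict (Ico (0 : ℝ) (2 * π))).map (circleMap 0 1)

instance : IsFiniteMeasure arcLength := by
  unfold arcLength; infer_instance

lemma injOn_circleMap_Ico : InjOn (circleMap 0 1) (Ico (0 : ℝ) (2 * π)) := by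
  exact injOn_circleMap_of_abs_sub_le' one_ne_zero (by simp)

lemma measurableEmbedding_circleMap_Ico :
    MeasurableEmbedding (fun θ : Ico (0 : ℝ) (2 * π) ↦ circleMap 0 1 θ) := by
  have : StandardBorelSpace (Ico (0 : ℝ) (2 * π)) :=
    (measurableSet_Ico (a := (0 : ℝ)) (b := 2 * π)).standardBorel
  exact Measurable.measurableEmbedding (by fun_prop)
    (fun x y h ↦ Subtype.ext (injOn_circleMap_Ico x.2 y.2 h))

lemma arcLength_eq_map_comap :
    arcLength = (volume.comap ((↑) : Ico (0 : ℝ) (2 * π) → ℝ)).map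
      (fun θ : Ico (0 : ℝ) (2 * π) ↦ circleMap 0 1 θ) := by
  rw [arcLength, ← map_comap_subtype_coe (measurableSet_Ico (a := (0 : ℝ)) (b := 2 * π)),
    Measure.map_map (by fun_prop) (by fun_prop)]
  rfl

lemma ae_arcLength_iff {p : ℂ → Prop} :
    (∀ᵐ z ∂arcLength, p z) ↔
      ∀ᵐ θ ∂(volume : Measure ℝ).restrict (Ico (0 : ℝ) (2 * π)), p (circleMap 0 1 θ) := by
  rw [arcLength_eq_map_comap, measurableEmbedding_circleMap_Ico.ae_map_iff]
  exact (ae_restrict_iff_subtype (μ := volume) (p := fun θ ↦ p (circleMap 0 1 θ))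
    (measurableSet_Ico (a := (0 : ℝ)) (b := 2 * π))).symm

lemma integral_arcLength (g : ℂ → ℝ) :
    ∫ z, g z ∂arcLength = 2 * π * circleAverage g 0 1 := by
  rw [arcLength_eq_map_comap, measurableEmbedding_circleMap_Ico.integral_map,
    integral_subtype_comap measurableSet_Ico (fun θ ↦ g (circleMap 0 1 θ)),
    integral_Ico_eq_integral_Ioc, circleAverage_def,
    intervalIntegral.integral_of_le (by positivity), smul_eq_mul,
    mul_inv_cancel_left₀ (by positivity)]

lemma arcLength_ae_norm_eq_one : ∀ᵐ z ∂arcLength, ‖z‖ = 1 := by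
  rw [ae_arcLength_iff]
  simp

@[fun_prop]
lemma measurable_poissonKernel (c w : ℂ) : Measurable (poissonKernel c w) := by
  simp only [funext fun z ↦ poissonKernel_def c w z]
  fun_prop

lemma circleAverage_poissonKernel_mul_re {F : ℂ → ℂ} (hF : DifferentiableOn ℂ F (closedBall 0 1))
    {w : ℂ} (hw : w ∈ ball (0 : ℂ) 1) :
    circleAverage (fun ζ ↦ poissonKernel 0 w ζ * (F ζ).re) 0 1 = (F w).re := by
  have hF' : DiffContOnCl ℂ F (ball 0 1) :=
    DifferentiableOn.diffContOnCl (by rwa [closure_ball _ one_ne_zero])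
  rw [← hF'.circleAverage_poissonKernel_smul hw, ← reCLM_apply,
    ← reCLM.circleAverage_comp_comm]
  · simp [Function.comp_def]
  · refine ContinuousOn.circleIntegrable zero_le_one ?_
    rw [poissonKernel_eq_re_herglotzRieszKernel]
    have h := continuousOn_herglotzRieszKernel_sphere hw
    rw [abs_one] at h
    exact (continuous_re.comp_continuousOn h).smul (hF.continuousOn.mono sphere_subset_closedBall)

lemma poissonIntegral_arcLength {w : ℂ} (hw : w ∈ ball (0 : ℂ) 1) :
    poissonIntegral arcLength w = 2 * π := by
  have h := circleAverage_poissonKernel_mul_re (F := fun _ ↦ 1)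
    (differentiableOn_const (c := (1 : ℂ)) (s := closedBall 0 1)) hw
  rw [poissonIntegral, integral_arcLength]
  simpa using h

lemma poissonKernel_zero_eq {w ζ : ℂ} (hζ : ‖ζ‖ = 1) :
    poissonKernel 0 w ζ = (1 - ‖w‖ ^ 2) / ‖ζ - w‖ ^ 2 := by
  simp [poissonKernel_def, hζ]

lemma poissonKernel_zero_bounds {w ζ : ℂ} (hw : w ∈ ball (0 : ℂ) 1) (hζ : ‖ζ‖ = 1) :
    (1 - ‖w‖) / (1 + ‖w‖) ≤ poissonKernel 0 w ζ ∧
      poissonKernel 0 w ζ ≤ (1 + ‖w‖) / (1 - ‖w‖) := by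
  rw [poissonKernel_eq_re_herglotzRieszKernel]
  have hζ' : ζ ∈ sphere (0 : ℂ) 1 := by simpa using hζ
  have h1 := le_re_herglotzRieszKernel hζ' hw
  have h2 := re_herglotzRieszKernel_le hζ' hw
  simpa [herglotzRieszKernel_def] using And.intro h1 h2

section
variable {μ : Measure ℂ} [IsFiniteMeasure μ] {w : ℂ}

lemma poissonKernel_nonneg {ζ : ℂ} (hw : w ∈ ball (0 : ℂ) 1) (hζ : ‖ζ‖ = 1) :
    0 ≤ poissonKernel 0 w ζ := by
  have : ‖w‖ < 1 := by simpa using hw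
  exact le_trans (div_nonneg (by linarith) (by positivity)) (poissonKernel_zero_bounds hw hζ).1

lemma integrable_poissonKernel (hμ : ∀ᵐ ζ ∂μ, ‖ζ‖ = 1) (hw : w ∈ ball (0 : ℂ) 1) :
    Integrable (poissonKernel 0 w) μ := by
  refine Integrable.of_bound (by fun_prop) ((1 + ‖w‖) / (1 - ‖w‖)) ?_
  filter_upwards [hμ] with ζ hζ
  rw [Real.norm_eq_abs, abs_of_nonneg (poissonKernel_nonneg hw hζ)]
  exact (poissonKernel_zero_bounds hw hζ).2

lemma le_poissonIntegral (hμ : ∀ᵐ ζ ∂μ, ‖ζ‖ = 1) (hw : w ∈ ball (0 : ℂ) 1) :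
    μ.real univ * ((1 - ‖w‖) / (1 + ‖w‖)) ≤ poissonIntegral μ w := by
  have h := integral_mono_ae (integrable_const ((1 - ‖w‖) / (1 + ‖w‖)))
    (integrable_poissonKernel hμ hw) (by
      filter_upwards [hμ] with ζ hζ using (poissonKernel_zero_bounds hw hζ).1)
  simpa [poissonIntegral] using h

lemma ofReal_poissonIntegral (hμ : ∀ᵐ ζ ∂μ, ‖ζ‖ = 1) (hw : w ∈ ball (0 : ℂ) 1) :
    ENNReal.ofReal (poissonIntegral μ w) = ∫⁻ ζ, ENNReal.ofReal (poissonKernel 0 w ζ) ∂μ :=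
  ofReal_integral_eq_lintegral_ofReal (integrable_poissonKernel hμ hw) (by
    filter_upwards [hμ] with ζ hζ using poissonKernel_nonneg hw hζ)
end

lemma poissonKernel_radial {b ζ : ℂ} (hb : ‖b‖ = 1) (hζ : ‖ζ‖ = 1) (r : ℝ) :
    poissonKernel 0 (r * b) ζ = (1 - r ^ 2) / ((1 - r) ^ 2 + r * dist ζ b ^ 2) := by
  rw [poissonKernel_zero_eq hζ, dist_eq_norm]
  have h1 : ζ.re ^ 2 + ζ.im ^ 2 = 1 := by
    have := Complex.sq_norm ζ
    rw [hζ, normSq_apply] at this; linarith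
  have h2 : b.re ^ 2 + b.im ^ 2 = 1 := by
    have := Complex.sq_norm b
    rw [hb, normSq_apply] at this; linarith
  congr 1
  · simp [hb]
  · rw [Complex.sq_norm, Complex.sq_norm, normSq_apply, normSq_apply]
    simp only [sub_re, sub_im, re_ofReal_mul, im_ofReal_mul]
    linear_combination (1 - r) * h1 - (r - r ^ 2) * h2

/-- If `ρ` is dominated by `K • μ` on all small balls centred at `b`, then so is its radial
Poisson integral at `b`, up to an error coming from the part away from `b`. -/
lemma poissonIntegral_radial_le {ρ μ : Measure ℂ} [IsFiniteMeasure ρ] [IsFiniteMeasure μ]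
    (hρ : ∀ᵐ ζ ∂ρ, ‖ζ‖ = 1) (hμ : ∀ᵐ ζ ∂μ, ‖ζ‖ = 1) {b : ℂ} (hb : ‖b‖ = 1) {K : ℝ}
    (hK : 0 ≤ K) {δ : ℝ} (hδ : 0 < δ)
    (h : ∀ s ∈ Ioo 0 δ, ρ (closedBall b s) ≤ ENNReal.ofReal K * μ (closedBall b s))
    {r : ℝ} (hr : r ∈ Ioo (0 : ℝ) 1) :
    poissonIntegral ρ (r * b) ≤
      (1 - r ^ 2) / ((1 - r) ^ 2 + r * δ ^ 2) * ρ.real univ + K * poissonIntegral μ (r * b) := by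
  obtain ⟨hr0, hr1⟩ := hr
  have hw : (r : ℂ) * b ∈ ball (0 : ℂ) 1 := by simp [hb, abs_of_pos hr0, hr1]
  set g : ℂ → ℝ := fun ζ ↦ (1 - r ^ 2) / ((1 - r) ^ 2 + r * dist ζ b ^ 2) with hg
  set T : ℝ := (1 - r ^ 2) / ((1 - r) ^ 2 + r * δ ^ 2) with hT
  have hr2 : 0 < 1 - r ^ 2 := by nlinarith
  have hr3 : 0 < 1 - r := by linarith
  have hT0 : 0 < T := by positivity
  have hgm : Measurable g := by fun_prop
  have hg0 : ∀ ζ, 0 ≤ g ζ := fun ζ ↦ by positivity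
  have key : ∀ {ν : Measure ℂ} [IsFiniteMeasure ν], (∀ᵐ ζ ∂ν, ‖ζ‖ = 1) →
      ENNReal.ofReal (poissonIntegral ν (r * b)) = ∫⁻ t in Ioi 0, ν {ζ | t ≤ g ζ} := by
    intro ν _ hν
    rw [ofReal_poissonIntegral hν hw, ← lintegral_eq_lintegral_meas_le ν (ae_of_all _ hg0)
      hgm.aemeasurable]
    refine lintegral_congr_ae ?_
    filter_upwards [hν] with ζ hζ
    rw [poissonKernel_radial hb hζ]
  have hpos : ∀ {ν : Measure ℂ} [IsFiniteMeasure ν], (∀ᵐ ζ ∂ν, ‖ζ‖ = 1) →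
      0 ≤ poissonIntegral ν (r * b) := by
    intro ν _ hν
    refine integral_nonneg_of_ae ?_
    filter_upwards [hν] with ζ hζ using poissonKernel_nonneg hw hζ
  have hlevel : ∀ᵐ t : ℝ, t ∈ Ioi (0 : ℝ) → ρ {ζ | t ≤ g ζ} ≤
      (Ioc 0 T).indicator (fun _ ↦ ρ univ) t + ENNReal.ofReal K * μ {ζ | t ≤ g ζ} := by
    have hne : ∀ᵐ t : ℝ, t ≠ (1 - r ^ 2) / (1 - r) ^ 2 := by
      simp [ae_iff]
    filter_upwards [hne] with t ht ht0
    have ht0 : 0 < t := ht0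
    by_cases htT : t ≤ T
    · rw [indicator_of_mem (mem_Ioc.2 ⟨ht0, htT⟩)]
      exact (measure_mono (subset_univ _)).trans le_self_add
    · push Not at htT
      rw [indicator_of_notMem (fun h ↦ absurd h.2 (not_le.2 htT)), zero_add]
      have hiff : ∀ ζ, t ≤ g ζ ↔ dist ζ b ^ 2 ≤ ((1 - r ^ 2) / t - (1 - r) ^ 2) / r := by
        intro ζ
        rw [hg]
        simp only
        have hden : 0 < (1 - r) ^ 2 + r * dist ζ b ^ 2 := by positivity
        have hsub := le_sub_iff_add_le (a := dist ζ b ^ 2 * r) (b := (1 - r) ^ 2)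
          (c := (1 - r ^ 2) / t)
        rw [le_div_iff₀ hden, le_div_iff₀ hr0, hsub, le_div_iff₀ ht0]
        constructor <;> intro h <;> nlinarith
      set q := ((1 - r ^ 2) / t - (1 - r) ^ 2) / r with hq
      rcases lt_trichotomy q 0 with hq0 | hq0 | hq0
      · have : {ζ | t ≤ g ζ} = ∅ := by
          ext ζ
          simp only [mem_ofPred_eq, hiff, mem_empty_iff_false, iff_false, not_le]
          exact hq0.trans_le (by positivity)
        simp [this]
      · exfalso
        apply ht
        rw [hq, div_eq_zero_iff] at hq0
        rcases hq0 with h | h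
        · have : (1 - r ^ 2) / t = (1 - r) ^ 2 := by linarith
          rw [eq_div_iff (by positivity), ← this]
          field_simp
        · exact absurd h hr0.ne'
      · have hs : {ζ | t ≤ g ζ} = closedBall b √q := by
          ext ζ
          rw [mem_ofPred_eq, hiff, mem_closedBall, Real.le_sqrt dist_nonneg hq0.le]
        rw [hs]
        refine h _ (mem_Ioo.2 ⟨Real.sqrt_pos.2 hq0, ?_⟩)
        rw [Real.sqrt_lt' hδ, hq, div_lt_iff₀ hr0, sub_lt_iff_lt_add, div_lt_iff₀ ht0]
        rw [hT, div_lt_iff₀ (by positivity)] at htT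
        nlinarith
  have hmain : ENNReal.ofReal (poissonIntegral ρ (r * b)) ≤
      ENNReal.ofReal (T * ρ.real univ + K * poissonIntegral μ (r * b)) := by
    rw [ENNReal.ofReal_add (by positivity) (mul_nonneg hK (hpos hμ)), ENNReal.ofReal_mul hT0.le,
      ENNReal.ofReal_mul hK, key hρ, key hμ]
    calc _ ≤ ∫⁻ t in Ioi 0, ((Ioc 0 T).indicator (fun _ ↦ ρ univ) t +
          ENNReal.ofReal K * μ {ζ | t ≤ g ζ}) :=
          setLIntegral_mono_ae' measurableSet_Ioi hlevel
      _ = _ := by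
        rw [lintegral_add_left (measurable_const.indicator measurableSet_Ioc),
          lintegral_const_mul' _ _ ENNReal.ofReal_ne_top,
          lintegral_indicator_const measurableSet_Ioc,
          Measure.restrict_apply measurableSet_Ioc,
          inter_eq_left.2 (fun x hx ↦ hx.1), Real.volume_Ioc, sub_zero, mul_comm,
          ofReal_measureReal]
  exact (ENNReal.ofReal_le_ofReal_iff (add_nonneg (by positivity)
    (mul_nonneg hK (hpos hμ)))).1 hmain

lemma exists_poissonIntegral_eq_re {F : ℂ → ℂ} (hF : DifferentiableOn ℂ F (ball 0 1))
    (hre : ∀ z ∈ ball (0 : ℂ) 1, 0 ≤ (F z).re) :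
    ∃ μ : Measure ℂ, IsFiniteMeasure μ ∧ (∀ᵐ ζ ∂μ, ‖ζ‖ = 1) ∧
      ∀ w ∈ ball (0 : ℂ) 1, poissonIntegral μ w = (F w).re := by
  have hsphere : ∀ᵐ z ∂arcLength, z ∈ sphere (0 : ℂ) 1 := by
    simpa using arcLength_ae_norm_eq_one
  have hrestrict := Measure.restrict_eq_self_of_ae_mem hsphere
  have hdil : ∀ r ∈ Ioo (0 : ℝ) 1, MapsTo (fun z : ℂ ↦ r * z) (closedBall 0 1) (ball 0 1) := by
    intro r hr z hz
    simp only [mem_closedBall, dist_zero_right, mem_ball, norm_mul, norm_real,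
      Real.norm_eq_abs, abs_of_pos hr.1] at hz ⊢
    nlinarith [hr.1, hr.2]
  have hdiff : ∀ r ∈ Ioo (0 : ℝ) 1,
      DifferentiableOn ℂ (fun z : ℂ ↦ F (r * z)) (closedBall 0 1) := fun r hr ↦
    hF.comp (by fun_prop) (hdil r hr)
  let d : ℝ → ℂ → ℝ := fun r z ↦ (2 * π)⁻¹ * (F (r * z)).re
  have hdcont : ∀ r ∈ Ioo (0 : ℝ) 1, ContinuousOn (d r) (sphere 0 1) := fun r hr ↦
    (continuous_re.comp_continuousOn
      ((hdiff r hr).continuousOn.mono sphere_subset_closedBall)).const_mul _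
      |>.congr fun _ _ ↦ rfl
  have hdint : ∀ r ∈ Ioo (0 : ℝ) 1, Integrable (d r) arcLength := fun r hr ↦ by
    rw [← hrestrict]
    exact (hdcont r hr).integrableOn_compact (isCompact_sphere 0 1)
  let ν : ℝ → Measure ℂ := fun r ↦ arcLength.withDensity fun z ↦ ENNReal.ofReal (d r z)
  have hνfin : ∀ r ∈ Ioo (0 : ℝ) 1, IsFiniteMeasure (ν r) := fun r hr ↦
    isFiniteMeasure_withDensity_ofReal (hdint r hr).2
  have hνsphere : ∀ r, ∀ᵐ z ∂ν r, z ∈ sphere (0 : ℂ) 1 := fun r ↦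
    (withDensity_absolutelyContinuous _ _).ae_le hsphere
  have hνint : ∀ r ∈ Ioo (0 : ℝ) 1, ∀ w ∈ ball (0 : ℂ) 1,
      poissonIntegral (ν r) w = (F (r * w)).re := by
    intro r hr w hw
    rw [← circleAverage_poissonKernel_mul_re (hdiff r hr) hw, poissonIntegral,
      integral_withDensity_eq_integral_toReal_smul₀ (hdint r hr).aemeasurable.ennreal_ofReal
        (ae_of_all _ fun _ ↦ ENNReal.ofReal_lt_top)]
    have : ∀ᵐ z ∂arcLength, (ENNReal.ofReal (d r z)).toReal • poissonKernel 0 w z =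
        (2 * π)⁻¹ * (poissonKernel 0 w z * (F (r * z)).re) := by
      filter_upwards [hsphere] with z hz
      have : 0 ≤ d r z := mul_nonneg (by positivity)
        (hre _ (hdil r hr (sphere_subset_closedBall hz)))
      rw [ENNReal.toReal_ofReal this, smul_eq_mul]
      ring
    rw [integral_congr_ae this, integral_const_mul, integral_arcLength,
      inv_mul_cancel_left₀ (by positivity)]
  let r : ℕ → ℝ := fun n ↦ 1 - 1 / (n + 2)
  have hr : ∀ n, r n ∈ Ioo (0 : ℝ) 1 := by
    intro n
    have h1 : (0 : ℝ) < n + 2 := by positivity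
    have h2 : 1 / ((n : ℝ) + 2) < 1 := by rw [div_lt_one h1]; linarith [n.cast_nonneg (α := ℝ)]
    have h3 : 0 < 1 / ((n : ℝ) + 2) := by positivity
    exact ⟨by simp only [r]; linarith, by simp only [r]; linarith⟩
  have hrlim : Tendsto r atTop (𝓝 1) := by
    have h : Tendsto (fun n : ℕ ↦ 1 / ((n : ℝ) + 2)) atTop (𝓝 0) :=
      tendsto_const_nhds.div_atTop
        (tendsto_atTop_add_const_right _ _ tendsto_natCast_atTop_atTop)
    simpa [r] using h.const_sub 1
  let m : ℕ → FiniteMeasure ℂ := fun n ↦ ⟨ν (r n), hνfin _ (hr n)⟩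
  have hcompact := isCompact_setOfPred_finiteMeasure_le_of_isCompact (F 0).re.toNNReal
    (isCompact_sphere (0 : ℂ) 1)
  have hm : ∀ n, m n ∈ {μ : FiniteMeasure ℂ | μ.mass ≤ (F 0).re.toNNReal ∧
      μ (sphere (0 : ℂ) 1)ᶜ = 0} := by
    intro n
    have := hνfin _ (hr n)
    constructor
    · have h := hνint _ (hr n) 0 (by simp)
      have h' : poissonIntegral (ν (r n)) 0 = (ν (r n)).real univ := by
        rw [poissonIntegral, integral_congr_ae (g := fun _ ↦ (1 : ℝ))]
        · simp
        · filter_upwards [hνsphere (r n)] with z hz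
          rw [poissonKernel_zero_eq (by simpa using hz)]
          have hz : ‖z‖ = 1 := by simpa using hz
          simp [hz]
      rw [h', mul_zero] at h
      rw [← h]
      apply le_of_eq
      ext
      rw [Real.coe_toNNReal _ measureReal_nonneg]
      rfl
    · rw [FiniteMeasure.null_iff_toMeasure_null]
      exact hνsphere (r n)
  obtain ⟨μ, hμ, hlim⟩ := hcompact.ultrafilter_le_nhds' ((Ultrafilter.of atTop).map m)
    (Ultrafilter.mem_map.2 (Filter.univ_mem' hm))
  have hμsphere : ∀ᵐ ζ ∂(μ : Measure ℂ), ‖ζ‖ = 1 := by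
    have h := hμ.2
    rw [FiniteMeasure.null_iff_toMeasure_null] at h
    filter_upwards [compl_mem_ae_iff.2 h] with z hz
    simpa using hz
  refine ⟨μ, inferInstance, hμsphere, fun w hw ↦ ?_⟩
  have hw1 : ‖w‖ < 1 := by simpa using hw
  let φ : BoundedContinuousFunction ℂ ℝ := BoundedContinuousFunction.ofNormedAddCommGroup
    (fun ζ ↦ (1 - ‖w‖ ^ 2) / max ‖ζ - w‖ (1 - ‖w‖) ^ 2)
    (by
      refine Continuous.div (by fun_prop) (by fun_prop) fun ζ ↦ ?_
      have : 0 < max ‖ζ - w‖ (1 - ‖w‖) := lt_max_of_lt_right (by linarith)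
      positivity)
    ((1 - ‖w‖ ^ 2) / (1 - ‖w‖) ^ 2)
    (by
      intro ζ
      have h1 : 0 < 1 - ‖w‖ := by linarith
      have h2 : 0 ≤ 1 - ‖w‖ ^ 2 := by nlinarith [norm_nonneg w]
      rw [Real.norm_eq_abs, abs_of_nonneg (by positivity)]
      gcongr
      exact le_max_right _ _)
  have hφ : ∀ κ : Measure ℂ, (∀ᵐ ζ ∂κ, ‖ζ‖ = 1) → ∫ ζ, φ ζ ∂κ = poissonIntegral κ w := by
    intro κ hκ
    refine integral_congr_ae ?_
    filter_upwards [hκ] with ζ hζ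
    rw [poissonKernel_zero_eq hζ]
    have : 1 - ‖w‖ ≤ ‖ζ - w‖ := hζ ▸ norm_sub_norm_le ζ w
    change (1 - ‖w‖ ^ 2) / max ‖ζ - w‖ (1 - ‖w‖) ^ 2 = _
    rw [max_eq_left this]
  have hlim' : Tendsto m (Ultrafilter.of (atTop : Filter ℕ)) (𝓝 μ) := hlim
  have h1 := FiniteMeasure.tendsto_iff_forall_integral_tendsto.1 hlim' φ
  rw [hφ _ hμsphere] at h1
  have h2 : ∀ n, ∫ ζ, φ ζ ∂(m n : Measure ℂ) = (F (r n * w)).re := by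
    intro n
    have h := hνsphere (r n)
    simp only [mem_sphere_zero_iff_norm] at h
    exact (hφ _ h).trans (hνint _ (hr n) w hw)
  simp only [h2] at h1
  have h3 : Tendsto (fun n ↦ (F (r n * w)).re) atTop (𝓝 (F w).re) := by
    have hFc : ContinuousAt F w := (hF.differentiableAt (isOpen_ball.mem_nhds hw)).continuousAt
    have h4 : Tendsto (fun n ↦ (r n : ℂ) * w) atTop (𝓝 w) := by
      simpa using ((continuous_ofReal.tendsto 1).comp hrlim).mul_const w
    exact (continuous_re.tendsto _).comp (hFc.tendsto.comp h4)
  exact tendsto_nhds_unique h1 (h3.mono_left (Ultrafilter.of_le atTop))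

lemma antilipschitzWith_circleMap_Ico (c : ℝ) :
    AntilipschitzWith ⟨π / 2, by positivity⟩ (fun θ : Ico c (c + π) ↦ circleMap 0 1 θ) := by
  refine AntilipschitzWith.of_le_mul_dist fun x y ↦ ?_
  have hxy : |(x : ℝ) - y| ≤ π := by
    rw [abs_le]; constructor <;> linarith [x.2.1, x.2.2, y.2.1, y.2.2]
  have h1 : circleMap 0 1 x - circleMap 0 1 y =
      circleMap 0 1 y * (Complex.exp (I * ((x - y : ℝ) : ℂ)) - 1) := by
    simp only [circleMap_zero, ofReal_one, one_mul, mul_sub, ← Complex.exp_add, mul_one]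
    congr 2
    push_cast
    ring
  have h2 := Real.mul_abs_le_abs_sin (x := ((x : ℝ) - y) / 2) (by
    rw [abs_div, abs_two]; linarith)
  rw [Subtype.dist_eq, Real.dist_eq, dist_eq_norm, h1, norm_mul,
    Complex.norm_exp_I_mul_ofReal_sub_one, norm_mul]
  simp only [norm_circleMap_zero, abs_one, one_mul, Real.norm_eq_abs, abs_two]
  rw [abs_div, abs_two] at h2
  have hpi := Real.pi_pos
  calc |(x : ℝ) - y| = π * (2 / π * (|(x : ℝ) - y| / 2)) := by field_simp
    _ ≤ π * |Real.sin ((x - y) / 2)| := by gcongr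
    _ = π / 2 * (2 * |Real.sin ((x - y) / 2)|) := by ring

lemma volume_circleMap_preimage_inter_eq_zero {A : Set ℂ} (hA : μH[1] A = 0) (c : ℝ) :
    volume (circleMap 0 1 ⁻¹' A ∩ Ico c (c + π)) = 0 := by
  have h := (antilipschitzWith_circleMap_Ico c).hausdorffMeasure_preimage_le zero_le_one A
  rw [hA, mul_zero, nonpos_iff_eq_zero] at h
  have h' := (isometry_subtype_coe (s := Ico c (c + π))).hausdorffMeasure_image
    (Or.inl zero_le_one) ((fun θ : Ico c (c + π) ↦ circleMap 0 1 θ) ⁻¹' A)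
  rw [h, hausdorffMeasure_real] at h'
  convert! h' using 2
  ext θ
  simp [and_comm]

lemma arcLength_ae_notMem {A : Set ℂ} (hA : μH[1] A = 0) : ∀ᵐ z ∂arcLength, z ∉ A := by
  rw [ae_arcLength_iff, ae_restrict_iff' measurableSet_Ico, ae_iff]
  refine measure_mono_null ?_ (measure_union_null
    (volume_circleMap_preimage_inter_eq_zero hA 0) (volume_circleMap_preimage_inter_eq_zero hA π))
  intro θ hθ
  simp only [mem_ofPred_eq, Classical.not_imp, not_not] at hθ
  obtain ⟨⟨h0, h1⟩, h2⟩ := hθ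
  by_cases h : θ < π
  · exact Or.inl ⟨h2, h0, by linarith⟩
  · exact Or.inr ⟨h2, not_lt.1 h, by linarith⟩

lemma tendsto_poissonKernel_tail {δ : ℝ} (hδ : 0 < δ) :
    Tendsto (fun r : ℝ ↦ (1 - r ^ 2) / ((1 - r) ^ 2 + r * δ ^ 2)) (𝓝[<] 1) (𝓝 0) := by
  have h : ContinuousAt (fun r : ℝ ↦ (1 - r ^ 2) / ((1 - r) ^ 2 + r * δ ^ 2)) 1 :=
    ContinuousAt.div (by fun_prop) (by fun_prop) (by simp [hδ.ne'])
  have h' := h.tendsto.mono_left (nhdsWithin_le_nhds (s := Iio 1))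
  simpa using h'

/-- Comparison of radial Poisson integrals from a bound on the derivative of one measure with
respect to the other. -/
lemma exists_tendsto_zero_poissonIntegral_radial_le {ρ μ : Measure ℂ} [IsFiniteMeasure ρ]
    [IsFiniteMeasure μ] (hρ : ∀ᵐ ζ ∂ρ, ‖ζ‖ = 1) (hμ : ∀ᵐ ζ ∂μ, ‖ζ‖ = 1) {b : ℂ} (hb : ‖b‖ = 1)
    {L : ℝ≥0∞} (h : Tendsto (fun s ↦ ρ (closedBall b s) / μ (closedBall b s)) (𝓝[>] 0) (𝓝 L))
    {K : ℝ} (hK : 0 ≤ K) (hLK : L < ENNReal.ofReal K) :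
    ∃ e : ℝ → ℝ, Tendsto e (𝓝[<] 1) (𝓝 0) ∧
      ∀ᶠ r : ℝ in 𝓝[<] 1, poissonIntegral ρ (r * b) ≤ e r + K * poissonIntegral μ (r * b) := by
  obtain ⟨δ, hδ, hδ'⟩ := (mem_nhdsGT_iff_exists_Ioo_subset).1 (h.eventually_lt_const hLK)
  refine ⟨fun r ↦ (1 - r ^ 2) / ((1 - r) ^ 2 + r * δ ^ 2) * ρ.real univ, ?_, ?_⟩
  · simpa using (tendsto_poissonKernel_tail hδ).mul_const (ρ.real univ)
  · filter_upwards [Ioo_mem_nhdsLT (zero_lt_one' ℝ)] with r hr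
    refine poissonIntegral_radial_le hρ hμ hb hK hδ (fun s hs ↦ ?_) hr
    exact (ENNReal.div_le_iff_le_mul (Or.inr ENNReal.ofReal_ne_top)
      (Or.inl (measure_ne_top _ _))).1 (hδ' hs).le

/-- If the radial limits of the Poisson integral of `μ` vanish almost everywhere on the circle,
then they are infinite `μ`-almost everywhere. -/
lemma ae_tendsto_poissonIntegral_atTop {μ : Measure ℂ} [IsFiniteMeasure μ]
    (hμ : ∀ᵐ ζ ∂μ, ‖ζ‖ = 1)
    (hzero : ∀ᵐ b ∂arcLength,
      Tendsto (fun r : ℝ ↦ poissonIntegral μ (r * b)) (𝓝[<] 1) (𝓝 0)) :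
    ∀ᵐ b ∂μ, Tendsto (fun r : ℝ ↦ poissonIntegral μ (r * b)) (𝓝[<] 1) atTop := by
  have hball : ∀ b : ℂ, ‖b‖ = 1 → ∀ᶠ r : ℝ in 𝓝[<] 1, (r : ℂ) * b ∈ ball (0 : ℂ) 1 := by
    intro b hb
    filter_upwards [Ioo_mem_nhdsLT (zero_lt_one' ℝ)] with r hr
    simp [hb, abs_of_pos hr.1, hr.2]
  have hN : ∀ᵐ b ∂μ, ¬ Tendsto (fun r : ℝ ↦ poissonIntegral μ (r * b)) (𝓝[<] 1) (𝓝 0) →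
      arcLength.rnDeriv μ b = 0 := by
    set N := {b | ¬ Tendsto (fun r : ℝ ↦ poissonIntegral μ (r * b)) (𝓝[<] 1) (𝓝 0)}
    have h0 : ∫⁻ b in toMeasurable arcLength N, arcLength.rnDeriv μ b ∂μ = 0 := by
      have h := Measure.setLIntegral_rnDeriv_le (μ := arcLength) (ν := μ)
        (toMeasurable arcLength N)
      rwa [measure_toMeasurable, show arcLength N = 0 from hzero, nonpos_iff_eq_zero] at h
    rw [lintegral_eq_zero_iff (Measure.measurable_rnDeriv _ _)] at h0
    filter_upwards [(ae_restrict_iff' (measurableSet_toMeasurable _ _)).1 h0] with b hb hbN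
    exact hb (subset_toMeasurable _ _ hbN)
  filter_upwards [hμ, hN, Besicovitch.ae_tendsto_rnDeriv arcLength μ,
    Measure.rnDeriv_lt_top arcLength μ] with b hb hbN hlim hfin
  have hL : arcLength.rnDeriv μ b = 0 := by
    by_contra hne
    have hv : Tendsto (fun r : ℝ ↦ poissonIntegral μ (r * b)) (𝓝[<] 1) (𝓝 0) := by
      by_contra h
      exact hne (hbN h)
    obtain ⟨K, hK, hLK⟩ : ∃ K : ℝ, 0 ≤ K ∧ arcLength.rnDeriv μ b < ENNReal.ofReal K := by
      refine ⟨(arcLength.rnDeriv μ b).toReal + 1, by positivity, ?_⟩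
      rw [ENNReal.lt_ofReal_iff_toReal_lt hfin.ne]
      linarith
    obtain ⟨e, he, hle⟩ := exists_tendsto_zero_poissonIntegral_radial_le arcLength_ae_norm_eq_one
      hμ hb hlim hK hLK
    have h1 : Tendsto (fun r : ℝ ↦ e r + K * poissonIntegral μ (r * b)) (𝓝[<] 1) (𝓝 0) := by
      simpa using he.add (hv.const_mul K)
    have h2 : 2 * π ≤ 0 := by
      refine ge_of_tendsto h1 ?_
      filter_upwards [hle, hball b hb] with r hr hrb
      rwa [poissonIntegral_arcLength hrb] at hr
    linarith [Real.pi_pos]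
  rw [Filter.tendsto_atTop]
  intro M
  have hpi := Real.pi_pos
  obtain ⟨e, he, hle⟩ := exists_tendsto_zero_poissonIntegral_radial_le arcLength_ae_norm_eq_one
    hμ hb hlim (K := π / (|M| + 1)) (by positivity)
    (by rw [hL, ENNReal.ofReal_pos]; positivity)
  filter_upwards [hle, hball b hb, he.eventually_lt_const hpi] with r hr hrb hre
  rw [poissonIntegral_arcLength hrb] at hr
  have h3 : π < π / (|M| + 1) * poissonIntegral μ (r * b) := by linarith
  rw [div_mul_eq_mul_div, lt_div_iff₀ (by positivity)] at h3
  have := lt_of_mul_lt_mul_left h3 hpi.le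
  linarith [le_abs_self M]

/-- A measure whose Poisson integral has vanishing radial limits almost everywhere is dominated by
any other measure whose Poisson integral is, up to a bounded error, radially larger wherever the
former blows up. -/
lemma measure_le_of_poissonIntegral_radial {μ σ : Measure ℂ} [IsFiniteMeasure μ]
    [IsFiniteMeasure σ] (hμ : ∀ᵐ ζ ∂μ, ‖ζ‖ = 1) (hσ : ∀ᵐ ζ ∂σ, ‖ζ‖ = 1)
    (hzero : ∀ᵐ b ∂arcLength,
      Tendsto (fun r : ℝ ↦ poissonIntegral μ (r * b)) (𝓝[<] 1) (𝓝 0))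
    (hle : ∀ b : ℂ, ‖b‖ = 1 →
      Tendsto (fun r : ℝ ↦ poissonIntegral μ (r * b)) (𝓝[<] 1) atTop →
      ∃ C, ∀ᶠ r : ℝ in 𝓝[<] 1, poissonIntegral μ (r * b) ≤ poissonIntegral σ (r * b) + C) :
    μ ≤ σ := by
  have hR : ∀ᵐ b ∂μ, 1 ≤ σ.rnDeriv μ b := by
    filter_upwards [hμ, ae_tendsto_poissonIntegral_atTop hμ hzero,
      Besicovitch.ae_tendsto_rnDeriv σ μ] with b hb htop hlim
    by_contra! hlt
    obtain ⟨K, hK1, hK2⟩ := ENNReal.lt_iff_exists_nnreal_btwn.1 hlt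
    have hK2 : (K : ℝ) < 1 := by exact_mod_cast hK2
    obtain ⟨C, hC⟩ := hle b hb htop
    obtain ⟨e, he, hle'⟩ := exists_tendsto_zero_poissonIntegral_radial_le hσ hμ hb hlim
      K.coe_nonneg (by simpa using hK1)
    have hbig := htop.eventually_gt_atTop ((C + 1) / (1 - K))
    obtain ⟨r, hr1, hr2, hr3, hr4⟩ :=
      (hC.and (hle'.and (hbig.and (he.eventually_lt_const zero_lt_one)))).exists
    rw [div_lt_iff₀ (by linarith)] at hr3
    linarith
  calc μ = μ.withDensity 1 := withDensity_one.symm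
    _ ≤ μ.withDensity (σ.rnDeriv μ) := withDensity_mono hR
    _ ≤ σ := Measure.withDensity_rnDeriv_le σ μ

lemma exists_pos_mul_one_sub_norm_le {f : ℂ → ℂ} (hf : DifferentiableOn ℂ f (ball 0 1))
    (hmaps : MapsTo f (ball 0 1) (ball 0 1)) :
    ∃ c > 0, ∀ z ∈ ball (0 : ℂ) 1, c * (1 - ‖z‖) ≤ ‖1 - f z‖ := by
  have hre : ∀ z ∈ ball (0 : ℂ) 1, 0 < (1 - f z).re := by
    intro z hz
    have h1 : ‖f z‖ < 1 := by simpa using hmaps hz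
    rw [sub_re, one_re]
    linarith [re_le_norm (f z)]
  obtain ⟨μ, _, hμ, hμf⟩ := exists_poissonIntegral_eq_re (F := fun z ↦ 1 - f z)
    (by fun_prop) (fun z hz ↦ (hre z hz).le)
  have hpos : 0 < μ.real univ := by
    have h0 : (0 : ℂ) ∈ ball (0 : ℂ) 1 := by simp
    refine measureReal_nonneg.lt_of_ne fun h ↦ (hre 0 h0).ne' ?_
    have hμ0 : μ = 0 := by
      rw [← Measure.measure_univ_eq_zero]
      exact (measureReal_eq_zero_iff).1 h.symm
    rw [← hμf 0 h0, hμ0, poissonIntegral, integral_zero_measure]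
  refine ⟨μ.real univ / 2, by positivity, fun z hz ↦ ?_⟩
  have hz1 : ‖z‖ < 1 := by simpa using hz
  calc μ.real univ / 2 * (1 - ‖z‖) = μ.real univ * ((1 - ‖z‖) / 2) := by ring
    _ ≤ μ.real univ * ((1 - ‖z‖) / (1 + ‖z‖)) := by
      gcongr
      linarith
    _ ≤ poissonIntegral μ z := le_poissonIntegral hμ hz
    _ = (1 - f z).re := hμf z hz
    _ ≤ ‖1 - f z‖ := re_le_norm _

lemma re_one_add_div_one_sub (z : ℂ) :
    ((1 + z) / (1 - z)).re = (1 - ‖z‖ ^ 2) / ‖1 - z‖ ^ 2 := by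
  have h := congrFun (poissonKernel_eq_re_herglotzRieszKernel (c := 0) (w := z)) 1
  simpa [poissonKernel_def, herglotzRieszKernel_def] using h.symm

lemma tendsto_re_one_add_div_one_sub {α : Type*} {l : Filter α} {g : α → ℂ} {L : ℂ}
    (hg : Tendsto g l (𝓝 L)) (hL : ‖L‖ = 1) (hL1 : L ≠ 1) :
    Tendsto (fun x ↦ ((1 + g x) / (1 - g x)).re) l (𝓝 0) := by
  have h : ContinuousAt (fun z : ℂ ↦ (1 - ‖z‖ ^ 2) / ‖1 - z‖ ^ 2) L :=
    ContinuousAt.div (by fun_prop) (by fun_prop) (by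
      simpa [sub_eq_zero] using hL1.symm)
  simp only [re_one_add_div_one_sub]
  simpa [hL, Function.comp_def] using h.tendsto.comp hg

lemma tendsto_one_of_tendsto_re_atTop {α : Type*} {l : Filter α} {g : α → ℂ}
    (h : Tendsto (fun x ↦ ((1 + g x) / (1 - g x)).re) l atTop) : Tendsto g l (𝓝 1) := by
  simp only [re_one_add_div_one_sub] at h
  have h0 := (Real.continuous_sqrt.tendsto 0).comp h.inv_tendsto_atTop
  rw [Real.sqrt_zero] at h0
  rw [tendsto_iff_norm_sub_tendsto_zero]
  refine squeeze_zero' (Eventually.of_forall fun _ ↦ norm_nonneg _) ?_ h0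
  filter_upwards [h.eventually_gt_atTop 0] with x hx
  rw [norm_sub_rev]
  refine Real.le_sqrt_of_sq_le ?_
  simp only [Pi.inv_apply, inv_div]
  have h1 : 0 < ‖1 - g x‖ ^ 2 := by
    by_contra h1
    have h2 : ‖1 - g x‖ ^ 2 = 0 := le_antisymm (not_lt.1 h1) (by positivity)
    rw [h2, div_zero] at hx
    exact lt_irrefl _ hx
  have h3 : 0 < 1 - ‖g x‖ ^ 2 := (div_pos_iff_of_pos_right h1).1 hx
  rw [le_div_iff₀ h3]
  nlinarith [mul_nonneg h1.le (sq_nonneg ‖g x‖)]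

lemma exists_norm_cayley_sub_le {f B : ℂ → ℂ} (hf : DifferentiableOn ℂ f (ball 0 1))
    (hf_maps : MapsTo f (ball 0 1) (ball 0 1)) (hB : DifferentiableOn ℂ B (ball 0 1))
    (hB_maps : MapsTo B (ball 0 1) (ball 0 1)) {b : ℂ} (hb : ‖b‖ = 1) (k : ℕ)
    (hO : ∃ C > (0 : ℝ), ∃ δ > (0 : ℝ), ∀ ζ ∈ ball (0 : ℂ) 1,
      ‖ζ - b‖ < δ → ‖f ζ - B ζ‖ ≤ C * ‖ζ - b‖ ^ (k + 2)) :
    ∃ C, ∀ᶠ r : ℝ in 𝓝[<] 1,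
      ‖(1 + f (r * b)) / (1 - f (r * b)) - (1 + B (r * b)) / (1 - B (r * b))‖ ≤
        C * (1 - r) ^ k := by
  obtain ⟨C, hC, δ, hδ, hO⟩ := hO
  obtain ⟨c₁, hc₁, h₁⟩ := exists_pos_mul_one_sub_norm_le hf hf_maps
  obtain ⟨c₂, hc₂, h₂⟩ := exists_pos_mul_one_sub_norm_le hB hB_maps
  refine ⟨2 * C / (c₁ * c₂), ?_⟩
  filter_upwards [Ioo_mem_nhdsLT (zero_lt_one' ℝ), Ioo_mem_nhdsLT (sub_lt_self (1 : ℝ) hδ)]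
    with r hr hr'
  have hr1 : 0 < 1 - r := by linarith [hr.2]
  have hnorm : ‖(r : ℂ) * b‖ = r := by simp [hb, abs_of_pos hr.1]
  have hmem : (r : ℂ) * b ∈ ball (0 : ℂ) 1 := by rw [mem_ball_zero_iff, hnorm]; exact hr.2
  have hdist : ‖(r : ℂ) * b - b‖ = 1 - r := by
    rw [show (r : ℂ) * b - b = ((r - 1 : ℝ) : ℂ) * b by push_cast; ring, norm_mul, hb, mul_one,
      norm_real, Real.norm_eq_abs, abs_sub_comm, abs_of_pos hr1]
  have h₀ := hO _ hmem (by rw [hdist]; linarith [hr'.1])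
  have h₁ := h₁ _ hmem
  have h₂ := h₂ _ hmem
  rw [hnorm] at h₁ h₂
  rw [hdist] at h₀
  set z := f (r * b)
  set w := B (r * b)
  have hz : 0 < ‖1 - z‖ := lt_of_lt_of_le (by positivity) h₁
  have hw : 0 < ‖1 - w‖ := lt_of_lt_of_le (by positivity) h₂
  have heq : (1 + z) / (1 - z) - (1 + w) / (1 - w) = 2 * (z - w) / ((1 - z) * (1 - w)) := by
    have hz' := norm_pos_iff.1 hz
    have hw' := norm_pos_iff.1 hw
    field_simp
    ring
  rw [heq, norm_div, norm_mul, norm_mul, Complex.norm_ofNat]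
  calc 2 * ‖z - w‖ / (‖1 - z‖ * ‖1 - w‖)
      ≤ 2 * (C * (1 - r) ^ (k + 2)) / ((c₁ * (1 - r)) * (c₂ * (1 - r))) := by gcongr
    _ = 2 * C / (c₁ * c₂) * (1 - r) ^ k := by
      field_simp
      ring

/-- **Generalization of Chelst's theorem.**  Let `f` and `B` be holomorphic
self-maps of the unit disc, with `B` inner (for almost every `θ ∈ [0, 2π)` the
radial limit of `B` at `e^{iθ}` exists and has modulus one).  Let `A_B` be
precisely the set of boundary points at which the radial limit of `B` exists
and equals `1`, and suppose `A_B` has one-dimensional (arc-length) measure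
zero.  If `f(ζ) = B(ζ) + O(|ζ - a|⁴)` as `ζ → a` for some `a ∈ A_B`, and
`f(ζ) = B(ζ) + O(|ζ - b|²)` as `ζ → b` for every other `b ∈ A_B`, then
`f ≡ B` on the disc. -/
theorem chelst_generalization
    (f B : ℂ → ℂ)
    (hf : DifferentiableOn ℂ f (ball (0 : ℂ) 1))
    (hf_maps : Set.MapsTo f (ball (0 : ℂ) 1) (ball (0 : ℂ) 1))
    (hB : DifferentiableOn ℂ B (ball (0 : ℂ) 1))
    (hB_maps : Set.MapsTo B (ball (0 : ℂ) 1) (ball (0 : ℂ) 1))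
    (hB_inner : ∀ᵐ (θ : ℝ) ∂((volume : Measure ℝ).restrict (Ico (0 : ℝ) (2 * π))),
      ∃ L : ℂ, Tendsto (fun r : ℝ => B ((r : ℂ) * Complex.exp ((θ : ℂ) * Complex.I)))
          (nhdsWithin 1 (Iio (1 : ℝ))) (nhds L) ∧ ‖L‖ = 1)
    (A_B : Set ℂ)
    (hA_B : A_B = {b : ℂ | ‖b‖ = 1 ∧
      Tendsto (fun r : ℝ => B ((r : ℂ) * b)) (nhdsWithin 1 (Iio (1 : ℝ)))
        (nhds 1)})
    (hA_null : μH[1] A_B = 0)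
    (a : ℂ) (ha : a ∈ A_B)
    (hOa : ∃ C > (0 : ℝ), ∃ δ > (0 : ℝ), ∀ ζ ∈ ball (0 : ℂ) 1,
      ‖ζ - a‖ < δ → ‖f ζ - B ζ‖ ≤ C * ‖ζ - a‖ ^ 4)
    (hOb : ∀ b ∈ A_B \ {a}, ∃ C > (0 : ℝ), ∃ δ > (0 : ℝ),
      ∀ ζ ∈ ball (0 : ℂ) 1, ‖ζ - b‖ < δ → ‖f ζ - B ζ‖ ≤ C * ‖ζ - b‖ ^ 2) :
    ∀ ζ ∈ ball (0 : ℂ) 1, f ζ = B ζ := by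
  subst hA_B
  have hsub : ∀ g : ℂ → ℂ, MapsTo g (ball 0 1) (ball 0 1) → ∀ z ∈ ball (0 : ℂ) 1, 1 - g z ≠ 0 := by
    intro g hg z hz h
    have h1 : ‖g z‖ < 1 := by simpa using hg hz
    rw [← sub_eq_zero.1 h, norm_one] at h1
    exact lt_irrefl _ h1
  have hdiff : ∀ g : ℂ → ℂ, DifferentiableOn ℂ g (ball 0 1) → MapsTo g (ball 0 1) (ball 0 1) →
      DifferentiableOn ℂ (fun z ↦ (1 + g z) / (1 - g z)) (ball 0 1) := fun g hg hg' ↦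
    (hg.const_add 1).div (hg.const_sub 1) (hsub g hg')
  have hre : ∀ g : ℂ → ℂ, MapsTo g (ball 0 1) (ball 0 1) → ∀ z ∈ ball (0 : ℂ) 1,
      0 ≤ ((1 + g z) / (1 - g z)).re := by
    intro g hg z hz
    have h1 : ‖g z‖ < 1 := by simpa using hg hz
    rw [re_one_add_div_one_sub]
    exact div_nonneg (by nlinarith [norm_nonneg (g z)]) (by positivity)
  have hrad : ∀ b : ℂ, ‖b‖ = 1 → ∀ᶠ r : ℝ in 𝓝[<] 1, (r : ℂ) * b ∈ ball (0 : ℂ) 1 := by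
    intro b hb
    filter_upwards [Ioo_mem_nhdsLT (zero_lt_one' ℝ)] with r hr
    simp [hb, abs_of_pos hr.1, hr.2]
  obtain ⟨σ, _, hσ, hσf⟩ := exists_poissonIntegral_eq_re (hdiff f hf hf_maps) (hre f hf_maps)
  obtain ⟨μ, _, hμ, hμB⟩ := exists_poissonIntegral_eq_re (hdiff B hB hB_maps) (hre B hB_maps)
  have hzero : ∀ᵐ b ∂arcLength,
      Tendsto (fun r : ℝ ↦ poissonIntegral μ (r * b)) (𝓝[<] 1) (𝓝 0) := by
    have hinner : ∀ᵐ b ∂arcLength,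
        ∃ L : ℂ, Tendsto (fun r : ℝ ↦ B (r * b)) (𝓝[<] 1) (𝓝 L) ∧ ‖L‖ = 1 := by
      rw [ae_arcLength_iff]
      simpa [circleMap_zero] using hB_inner
    filter_upwards [hinner, arcLength_ae_norm_eq_one, arcLength_ae_notMem hA_null]
      with b ⟨L, hL, hL1⟩ hb hbA
    have hne : L ≠ 1 := by
      rintro rfl
      exact hbA ⟨hb, hL⟩
    refine (tendsto_re_one_add_div_one_sub hL hL1 hne).congr' ?_
    filter_upwards [hrad b hb] with r hr using (hμB _ hr).symm
  obtain ⟨Ca, hCa⟩ := exists_norm_cayley_sub_le hf hf_maps hB hB_maps ha.1 2 hOa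
  have hle : μ ≤ σ := by
    refine measure_le_of_poissonIntegral_radial hμ hσ hzero fun b hb htop ↦ ?_
    have hbA : Tendsto (fun r : ℝ ↦ B (r * b)) (𝓝[<] 1) (𝓝 1) := by
      refine tendsto_one_of_tendsto_re_atTop (htop.congr' ?_)
      filter_upwards [hrad b hb] with r hr using hμB _ hr
    obtain ⟨C, hC⟩ : ∃ C, ∀ᶠ r : ℝ in 𝓝[<] 1,
        ‖(1 + f (r * b)) / (1 - f (r * b)) - (1 + B (r * b)) / (1 - B (r * b))‖ ≤ C := by
      by_cases hba : b = a
      · subst hba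
        refine ⟨|Ca|, ?_⟩
        filter_upwards [hCa, Ioo_mem_nhdsLT (zero_lt_one' ℝ)] with r hr hr'
        have h1 : (1 - r) ^ 2 ≤ 1 := by nlinarith [hr'.1, hr'.2]
        exact hr.trans ((mul_le_mul_of_nonneg_right (le_abs_self Ca) (sq_nonneg _)).trans
          (mul_le_of_le_one_right (abs_nonneg _) h1))
      · obtain ⟨C, hC⟩ := exists_norm_cayley_sub_le hf hf_maps hB hB_maps hb 0
          (hOb b ⟨⟨hb, hbA⟩, hba⟩)
        exact ⟨C, by simpa using hC⟩
    refine ⟨C, ?_⟩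
    filter_upwards [hC, hrad b hb] with r hr hrb
    rw [hμB _ hrb, hσf _ hrb]
    have h1 := (abs_le.1 ((abs_re_le_norm _).trans hr)).1
    rw [sub_re] at h1
    linarith
  obtain ⟨τ, hτ⟩ : ∃ τ : Measure ℂ, σ = μ + τ := ⟨σ - μ, by
    rw [add_comm, Measure.sub_add_cancel_of_le hle]⟩
  have hτσ : τ ≤ σ := hτ ▸ Measure.le_add_left le_rfl
  have : IsFiniteMeasure τ := isFiniteMeasure_of_le σ hτσ
  have hτ1 : ∀ᵐ ζ ∂τ, ‖ζ‖ = 1 := (Measure.absolutelyContinuous_of_le hτσ).ae_le hσ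
  have hadd : ∀ w ∈ ball (0 : ℂ) 1,
      poissonIntegral σ w = poissonIntegral μ w + poissonIntegral τ w := fun w hw ↦ by
    rw [hτ]
    exact integral_add_measure (integrable_poissonKernel hμ hw) (integrable_poissonKernel hτ1 hw)
  have hlim0 : Tendsto (fun r : ℝ ↦ Ca * (1 - r) ^ 2) (𝓝[<] 1) (𝓝 0) := by
    have h : Continuous fun r : ℝ ↦ Ca * (1 - r) ^ 2 := by fun_prop
    simpa using (h.tendsto 1).mono_left nhdsWithin_le_nhds
  have hτ0 : τ.real univ ≤ 0 := by
    have h : Tendsto (fun r : ℝ ↦ 2 * Ca * (1 - r)) (𝓝[<] 1) (𝓝 0) := by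
      have h : Continuous fun r : ℝ ↦ 2 * Ca * (1 - r) := by fun_prop
      simpa using (h.tendsto 1).mono_left nhdsWithin_le_nhds
    refine ge_of_tendsto h ?_
    filter_upwards [hCa, hrad a ha.1, Ioo_mem_nhdsLT (zero_lt_one' ℝ)] with r hr hra hr01
    have h1 := (abs_le.1 ((abs_re_le_norm _).trans hr)).2
    rw [sub_re, ← hσf _ hra, ← hμB _ hra, hadd _ hra] at h1
    have h2 := le_poissonIntegral hτ1 hra
    have hnorm : ‖(r : ℂ) * a‖ = r := by simp [ha.1, abs_of_pos hr01.1]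
    rw [hnorm] at h2
    have hr1 : 0 < 1 - r := by linarith [hr01.2]
    have h3 : (1 - r) / 2 ≤ (1 - r) / (1 + r) := by
      gcongr
      · linarith [hr01.1]
      · linarith [hr01.2]
    have h4 := mul_le_mul_of_nonneg_left h3 (measureReal_nonneg (μ := τ) (s := univ))
    have h5 : (1 - r) * τ.real univ ≤ (1 - r) * (2 * Ca * (1 - r)) := by linarith
    exact le_of_mul_le_mul_left h5 hr1
  have hτeq : τ = 0 := by
    rw [← Measure.measure_univ_eq_zero]
    exact (measureReal_eq_zero_iff).1 (le_antisymm hτ0 measureReal_nonneg)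
  have hanalytic : AnalyticOnNhd ℂ
      (fun z ↦ (1 + f z) / (1 - f z) - (1 + B z) / (1 - B z)) (ball 0 1) :=
    ((hdiff f hf hf_maps).sub (hdiff B hB hB_maps)).analyticOnNhd isOpen_ball
  obtain ⟨κ, hκ⟩ := hanalytic.eq_const_of_re_eq_const (c₀ := 0)
    (fun z hz ↦ by
      rw [sub_re, ← hσf z hz, ← hμB z hz, hadd z hz, hτeq]
      simp [poissonIntegral])
    isOpen_ball ⟨⟨0, by simp⟩, (convex_ball (0 : ℂ) 1).isPreconnected⟩
  have hκ0 : ‖κ‖ ≤ 0 := by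
    refine ge_of_tendsto hlim0 ?_
    filter_upwards [hCa, hrad a ha.1] with r hr hra
    rwa [hκ _ hra] at hr
  intro ζ hζ
  have h := hκ ζ hζ
  simp only [norm_le_zero_iff.1 hκ0, sub_eq_zero] at h
  rw [div_eq_div_iff (hsub f hf_maps ζ hζ) (hsub B hB_maps ζ hζ)] at h
  linear_combination h / 2
end
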